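/- Let N ≥ 1, and let k : {1,…,N}×{1,…,N} → ℝ be symmetric (k_{ij} = k_{ji}) with zero row sums (∑_{j=1}^N k_{ij} = 0 for every i) and nonnegative off-diagonal entries (k_{ij} ≥ 0 for i ≠ j). Let d ≥ 1, let n_1,…,n_N be unit vectors in ℝ^d, let s_1,…,s_N ∈ ℝ, set u_i := s_i·n_i, and let κ > 0. Then the discrete energy E₁^h := (κ/2) ∑_{i,j} k_{ij} (s_i − s_j)² + (1/2) ∑_{i,j} k_{ij} ((s_i² + s_j²)/2) ‖n_i − n_j‖² satisfies E₁^h ≥ min{κ, 1} · max{ (1/2) ∑_{i,j} k_{ij} ‖u_i − u_j‖², (1/2) ∑_{i,j} k_{ij} (s_i − s_j)² }. -/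

import Mathlib

theorem norm_smul_sub_smul_sq_of_norm_eq_one {E : Type*} [NormedAddCommGroup E]
    [InnerProductSpace ℝ E] {x y : E} (hx : ‖x‖ = 1) (hy : ‖y‖ = 1) (a b : ℝ) :
    ‖a • x - b • y‖ ^ 2 = (a - b) ^ 2 + a * b * ‖x - y‖ ^ 2 := by
  rw [norm_sub_sq_real, norm_sub_sq_real, norm_smul, norm_smul, real_inner_smul_left,
    real_inner_smul_right, hx, hy, mul_one, mul_one, Real.norm_eq_abs, Real.norm_eq_abs,
    sq_abs, sq_abs]
  ring

theorem norm_smul_sub_smul_sq_le_of_norm_eq_one {E : Type*} [NormedAddCommGroup E]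
    [InnerProductSpace ℝ E] {x y : E} (hx : ‖x‖ = 1) (hy : ‖y‖ = 1) (a b : ℝ) :
    ‖a • x - b • y‖ ^ 2 ≤ (a - b) ^ 2 + (a ^ 2 + b ^ 2) / 2 * ‖x - y‖ ^ 2 := by
  rw [norm_smul_sub_smul_sq_of_norm_eq_one hx hy]
  gcongr
  linarith [two_mul_le_add_sq a b]

/-- First assertion of Lemma 3.3 (coercivity):
`E₁ʰ ≥ min{κ,1} · max{∫|∇uₕ|², ∫|∇sₕ|²}` in nodal-sum form. -/
theorem discrete_energy_coercivity
    (N : ℕ) (hN : 1 ≤ N) (k : Fin N → Fin N → ℝ)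
    (hsym : ∀ i j, k i j = k j i)
    (hrow : ∀ i, ∑ j, k i j = 0)
    (hpos : ∀ i j, i ≠ j → 0 ≤ k i j)
    (d : ℕ) (hd : 1 ≤ d)
    (n : Fin N → EuclideanSpace ℝ (Fin d)) (hn : ∀ i, ‖n i‖ = 1)
    (s : Fin N → ℝ)
    (u : Fin N → EuclideanSpace ℝ (Fin d)) (hu : ∀ i, u i = s i • n i)
    (κ : ℝ) (hκ : 0 < κ) :
    (κ / 2) * ∑ i, ∑ j, k i j * (s i - s j) ^ 2
      + (1 / 2) * ∑ i, ∑ j, k i j * ((s i ^ 2 + s j ^ 2) / 2) * ‖n i - n j‖ ^ 2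
    ≥ min κ 1 *
        max ((1 / 2) * ∑ i, ∑ j, k i j * ‖u i - u j‖ ^ 2)
            ((1 / 2) * ∑ i, ∑ j, k i j * (s i - s j) ^ 2) := by
  have offdiag_sum_mono : ∀ f g : Fin N → Fin N → ℝ, (∀ i, f i i = g i i) →
      (∀ i j, f i j ≤ g i j) → ∑ i, ∑ j, k i j * f i j ≤ ∑ i, ∑ j, k i j * g i j := by
    intro f g hdiag hfg
    refine Finset.sum_le_sum fun i _ => Finset.sum_le_sum fun j _ => ?_
    obtain rfl | hij := eq_or_ne i j
    · rw [hdiag]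
    · exact mul_le_mul_of_nonneg_left (hfg i j) (hpos i j hij)
  set S := ∑ i, ∑ j, k i j * (s i - s j) ^ 2
  set D := ∑ i, ∑ j, k i j * ((s i ^ 2 + s j ^ 2) / 2) * ‖n i - n j‖ ^ 2 with hD
  have hS : 0 ≤ S := by
    simpa using offdiag_sum_mono 0 (fun i j => (s i - s j) ^ 2) (by simp)
      fun i j => sq_nonneg _
  have hD₀ : 0 ≤ D := by
    simpa [hD, mul_assoc] using offdiag_sum_mono 0
      (fun i j => (s i ^ 2 + s j ^ 2) / 2 * ‖n i - n j‖ ^ 2) (by simp)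
      fun i j => by simp only [Pi.zero_apply]; positivity
  have hU : ∑ i, ∑ j, k i j * ‖u i - u j‖ ^ 2 ≤ S + D := by
    refine (offdiag_sum_mono _
      (fun i j => (s i - s j) ^ 2 + (s i ^ 2 + s j ^ 2) / 2 * ‖n i - n j‖ ^ 2) (by simp)
      fun i j => ?_).trans_eq ?_
    · simpa only [hu] using norm_smul_sub_smul_sq_le_of_norm_eq_one (hn i) (hn j) (s i) (s j)
    · simp only [S, D, mul_add, Finset.sum_add_distrib, mul_assoc]
  have hm : 0 ≤ min κ 1 := le_min hκ.le zero_le_one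
  calc min κ 1 * max _ _ ≤ min κ 1 * ((1 / 2) * (S + D)) := by
        gcongr
        exact max_le (by linarith) (by linarith)
    _ = (1 / 2) * (min κ 1 * S + min κ 1 * D) := by ring
    _ ≤ (1 / 2) * (κ * S + 1 * D) := by
        gcongr
        · exact min_le_left _ _
        · exact min_le_right _ _
    _ = κ / 2 * S + 1 / 2 * D := by ring
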